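/- arXiv:1611.03790 — 2 statements merged into one kernel-verified Lean document; each statement's English description precedes it below -/
import Mathlib

section
/- Let C be a CSS code with K ≥ 1 and let C̃ be obtained from C by the full X-type generator splitting procedure. Then K̃ = K ≥ 1 and the X-distance satisfies d̃_X · (⌈w_X/2⌉ + 1) ≥ d_X. -/
open Matrix

/-- The weight of a vector over `F₂`: the number of nonzero entries. -/
def wt {α : Type*} [Fintype α] (v : α → ZMod 2) : ℕ :=
  (Finset.univ.filter fun j => v j ≠ 0).card

/-- Maximum weight of a row of a matrix over `F₂`. -/
def maxRowW {m α : Type*} [Fintype m] [Fintype α] (M : Matrix m α (ZMod 2)) : ℕ :=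
  Finset.univ.sup fun i => wt (M i)

/-- Maximum weight of a column of a matrix over `F₂`. -/
def maxColW {m α : Type*} [Fintype m] [Fintype α] (M : Matrix m α (ZMod 2)) : ℕ :=
  Finset.univ.sup fun j => wt fun i => M i j

/-- Total number of nonzero entries of a matrix over `F₂`. -/
def totW {m α : Type*} [Fintype m] [Fintype α] (M : Matrix m α (ZMod 2)) : ℕ :=
  ∑ i, wt (M i)

variable {N nX nZ : ℕ}

/-- Qubits of the code obtained by the full X-type generator splitting procedure:
the original `N` qubits, plus, for each row of `HX` of weight `w ≥ 4` (a "heavy" row),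
cut qubits `(1),…,(w−3)` (0-indexed below). -/
abbrev SplitQ (HX : Matrix (Fin nX) (Fin N) (ZMod 2)) : Type :=
  Fin N ⊕ Σ i : {i : Fin nX // 4 ≤ wt (HX i)}, Fin (wt (HX i.1) - 3)

/-- X-type generators of the fully split code: the rows of `HX` of weight `≤ 3`,
plus, for each heavy row, the `w−2` rows created by splitting it. -/
abbrev SplitXIdx (HX : Matrix (Fin nX) (Fin N) (ZMod 2)) : Type :=
  {i : Fin nX // ¬ 4 ≤ wt (HX i)} ⊕ Σ i : {i : Fin nX // 4 ≤ wt (HX i)}, Fin (wt (HX i.1) - 2)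

/-- X-type generator matrix of the code `C̃` obtained from `C` by applying the X-type
generator splitting step once to each row of `HX` of weight at least 4 (the result is the
same in any order).  Here `q i` enumerates, in a fixed order, the support of the heavy
row `i`.  Splitting a heavy row with support `{q₁,…,q_w}` produces `w−2` rows with
supports `{q₁,q₂,(1)}`, `{(m),q_{m+2},(m+1)}` for `m = 1,…,w−4`, and `{(w−3),q_{w−1},q_w}`,
on the original qubits together with that row's own cut qubits. -/
def splitHX (HX : Matrix (Fin nX) (Fin N) (ZMod 2))
    (q : ∀ i : {i : Fin nX // 4 ≤ wt (HX i)}, Fin (wt (HX i.1)) → Fin N) :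
    Matrix (SplitXIdx HX) (SplitQ HX) (ZMod 2) := fun r j =>
  match r, j with
  | Sum.inl i, Sum.inl p => HX i.1 p
  | Sum.inl _, Sum.inr _ => 0
  | Sum.inr ⟨i, r⟩, Sum.inl p =>
      have hw : 4 ≤ wt (HX i.1) := i.2
      if (r.val = 0 ∧ (p = q i ⟨0, by omega⟩ ∨ p = q i ⟨1, by omega⟩)) ∨
         (1 ≤ r.val ∧ r.val ≤ wt (HX i.1) - 4 ∧
           p = q i ⟨r.val + 1, by have := r.isLt; omega⟩) ∨
         (r.val = wt (HX i.1) - 3 ∧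
           (p = q i ⟨wt (HX i.1) - 2, by omega⟩ ∨ p = q i ⟨wt (HX i.1) - 1, by omega⟩))
      then 1 else 0
  | Sum.inr ⟨i, r⟩, Sum.inr ⟨i', c⟩ =>
      if i' = i ∧ (c.val = r.val ∨ c.val + 1 = r.val) then 1 else 0

/-- Z-type generator matrix of the code `C̃` obtained from `C` by the full X-type generator
splitting procedure: each row `R` of `HZ` agrees with `R` on the original qubits, and its
entry at the cut qubit `(m)` of heavy row `i` is the parity of
`|supp(R) ∩ {q_{i,1},…,q_{i,m+1}}|`. -/
def splitHZ (HX : Matrix (Fin nX) (Fin N) (ZMod 2)) (HZ : Matrix (Fin nZ) (Fin N) (ZMod 2))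
    (q : ∀ i : {i : Fin nX // 4 ≤ wt (HX i)}, Fin (wt (HX i.1)) → Fin N) :
    Matrix (Fin nZ) (SplitQ HX) (ZMod 2) := fun R j =>
  match j with
  | Sum.inl p => HZ R p
  | Sum.inr ⟨i, m⟩ => ∑ a : Fin (wt (HX i.1)), if a.val ≤ m.val + 1 then HZ R (q i a) else 0

/-- `distX HX HZ` is the X-distance of the CSS code with generator matrices `HX`, `HZ`:
the minimum weight of a vector in `ker(HZ)` not lying in the row space of `HX`. -/
noncomputable def distX {mX mZ α : Type*} [Fintype mX] [Fintype mZ] [Fintype α]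
    (HX : Matrix mX α (ZMod 2)) (HZ : Matrix mZ α (ZMod 2)) : ℕ :=
  sInf {k | ∃ v : α → ZMod 2, HZ.mulVec v = 0 ∧
    v ∉ Submodule.span (ZMod 2) (Set.range HX) ∧ wt v = k}

/-- `distZ HX HZ` is the Z-distance of the CSS code with generator matrices `HX`, `HZ`:
the minimum weight of a vector in `ker(HX)` not lying in the row space of `HZ`. -/
noncomputable def distZ {mX mZ α : Type*} [Fintype mX] [Fintype mZ] [Fintype α]
    (HX : Matrix mX α (ZMod 2)) (HZ : Matrix mZ α (ZMod 2)) : ℕ :=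
  sInf {k | ∃ v : α → ZMod 2, HX.mulVec v = 0 ∧
    v ∉ Submodule.span (ZMod 2) (Set.range HZ) ∧ wt v = k}

/-- Indicator vector of the first `n + 2` qubits, in the order `q`, of the heavy row `i`. -/
def prefixVec (HX : Matrix (Fin nX) (Fin N) (ZMod 2))
    (q : ∀ i : {i : Fin nX // 4 ≤ wt (HX i)}, Fin (wt (HX i.1)) → Fin N)
    (i : {i : Fin nX // 4 ≤ wt (HX i)}) (n : ℕ) : Fin N → ZMod 2 :=
  ∑ a, if a.val ≤ n + 1 then Pi.single (q i a) 1 else 0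

/-- The matrix replacing each cut qubit by the prefix of its heavy row that it stands for. -/
def cutMatrix (HX : Matrix (Fin nX) (Fin N) (ZMod 2))
    (q : ∀ i : {i : Fin nX // 4 ≤ wt (HX i)}, Fin (wt (HX i.1)) → Fin N) :
    Matrix (Fin N) (SplitQ HX) (ZMod 2) :=
  fromCols 1 (of fun p x => prefixVec HX q x.1 x.2 p)

/-- The cut qubit `n` of the heavy row `i` together with its prefix. -/
def prefixCut (HX : Matrix (Fin nX) (Fin N) (ZMod 2))
    (q : ∀ i : {i : Fin nX // 4 ≤ wt (HX i)}, Fin (wt (HX i.1)) → Fin N)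
    (i : {i : Fin nX // 4 ≤ wt (HX i)}) (n : ℕ) : SplitQ HX → ZMod 2 :=
  Sum.elim (prefixVec HX q i n) fun x => if x.1 = i ∧ x.2.val = n then 1 else 0

theorem wt_add_le {α : Type*} [Fintype α] (u v : α → ZMod 2) : wt (u + v) ≤ wt u + wt v := by
  classical
  refine le_trans (Finset.card_le_card ?_) (Finset.card_union_le _ _)
  intro p
  simp only [Finset.mem_filter, Finset.mem_union, Finset.mem_univ, true_and, Pi.add_apply]
  contrapose!
  rintro ⟨h, h'⟩
  simp [h, h']

theorem wt_sum_smul_le {α β : Type*} [Fintype α] [Fintype β] (v : β → ZMod 2)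
    (b : β → α → ZMod 2) (W : ℕ) (hb : ∀ j, wt (b j) ≤ W) :
    wt (∑ j, v j • b j) ≤ wt v * W := by
  classical
  have key : ∀ s : Finset β, wt (∑ j ∈ s, v j • b j) ≤ (s.filter fun j => v j ≠ 0).card * W := by
    intro s
    induction s using Finset.induction_on with
    | empty => simp [wt]
    | insert j s hj ih =>
      rw [Finset.sum_insert hj, Finset.filter_insert]
      by_cases h : v j = 0
      · simpa [h] using ih
      · have h1 : v j = 1 := Fin.eq_one_of_ne_zero _ h
        have := wt_add_le (v j • b j) (∑ j ∈ s, v j • b j)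
        rw [if_pos h, Finset.card_insert_of_notMem (by simp [hj]), add_mul, one_mul]
        have := hb j
        simp only [h1, one_smul] at *
        omega
  exact key Finset.univ

/-- A sub-indicator of `S` and its complement in `S` have total weight at most that of `S`. -/
theorem wt_add_wt_sub_le {α : Type*} [Fintype α] (u S : α → ZMod 2)
    (h : ∀ p, u p ≠ 0 → u p = S p) : wt u + wt (S - u) ≤ wt S := by
  classical
  unfold wt
  rw [← Finset.card_union_of_disjoint]
  · refine Finset.card_le_card fun p => ?_
    have := h p
    simp only [Finset.mem_filter, Finset.mem_union, Finset.mem_univ, true_and, Pi.sub_apply]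
    by_cases hu : u p = 0
    · simp [hu]
    · intro _
      rwa [← this hu]
  · rw [Finset.disjoint_left]
    intro p
    simp only [Finset.mem_filter, Finset.mem_univ, true_and, Pi.sub_apply, not_not]
    intro hu
    rw [h p hu, sub_self]

theorem cutMatrix_mulVec (HX : Matrix (Fin nX) (Fin N) (ZMod 2))
    (q : ∀ i : {i : Fin nX // 4 ≤ wt (HX i)}, Fin (wt (HX i.1)) → Fin N)
    (v : SplitQ HX → ZMod 2) :
    cutMatrix HX q *ᵥ v = v ∘ Sum.inl + ∑ x, v (Sum.inr x) • prefixVec HX q x.1 x.2 := by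
  ext p
  simp [cutMatrix, mulVec, dotProduct, mul_comm, one_apply]

theorem splitHZ_eq_mul (HX : Matrix (Fin nX) (Fin N) (ZMod 2))
    (HZ : Matrix (Fin nZ) (Fin N) (ZMod 2))
    (q : ∀ i : {i : Fin nX // 4 ≤ wt (HX i)}, Fin (wt (HX i.1)) → Fin N) :
    splitHZ HX HZ q = HZ * cutMatrix HX q := by
  ext R j
  rcases j with p | ⟨i, m⟩
  · simp [splitHZ, cutMatrix, mul_fromCols]
  · have : ∀ v : Fin N → ZMod 2, ∑ p, HZ R p * v p = HZ R ⬝ᵥ v := fun _ => rfl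
    simp only [splitHZ, cutMatrix, fromCols_apply_inr, mul_apply, of_apply, this]
    rw [prefixVec, dotProduct_sum]
    refine Finset.sum_congr rfl fun a _ => ?_
    split_ifs <;> simp

theorem cutMatrix_mulVec_surjective (HX : Matrix (Fin nX) (Fin N) (ZMod 2))
    (q : ∀ i : {i : Fin nX // 4 ≤ wt (HX i)}, Fin (wt (HX i.1)) → Fin N) :
    Function.Surjective (cutMatrix HX q).mulVecLin := fun u =>
  ⟨Sum.elim u 0, by rw [mulVecLin_apply, cutMatrix_mulVec]; ext p; simp⟩

section Rows

variable {HX : Matrix (Fin nX) (Fin N) (ZMod 2)}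
  {q : ∀ i : {i : Fin nX // 4 ≤ wt (HX i)}, Fin (wt (HX i.1)) → Fin N}

theorem prefixVec_apply_q (hinj : ∀ i, Function.Injective (q i))
    (i : {i : Fin nX // 4 ≤ wt (HX i)}) (n : ℕ) (a : Fin (wt (HX i.1))) :
    prefixVec HX q i n (q i a) = if a.val ≤ n + 1 then 1 else 0 := by
  rw [prefixVec, Finset.sum_apply, Finset.sum_eq_single a]
  · split_ifs <;> simp
  · intro b _ hb
    split_ifs
    · exact Pi.single_eq_of_ne (fun h => hb (hinj i h).symm) _
    · rfl
  · simp

theorem prefixVec_apply_of_notMem (i : {i : Fin nX // 4 ≤ wt (HX i)}) (n : ℕ) {p : Fin N}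
    (hp : p ∉ Set.range (q i)) : prefixVec HX q i n p = 0 := by
  rw [prefixVec, Finset.sum_apply]
  refine Finset.sum_eq_zero fun a _ => ?_
  split_ifs
  · exact Pi.single_eq_of_ne (fun h => hp ⟨a, h.symm⟩) _
  · rfl

theorem heavyRow_apply_q (hrange : ∀ i p, HX i.1 p ≠ 0 ↔ p ∈ Set.range (q i))
    (i : {i : Fin nX // 4 ≤ wt (HX i)}) (a : Fin (wt (HX i.1))) : HX i.1 (q i a) = 1 :=
  Fin.eq_one_of_ne_zero _ ((hrange i _).2 ⟨a, rfl⟩)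

theorem splitHX_first (hinj : ∀ i, Function.Injective (q i))
    (i : {i : Fin nX // 4 ≤ wt (HX i)}) (r : Fin (wt (HX i.1) - 2)) (hr : r.val = 0) :
    splitHX HX q (Sum.inr ⟨i, r⟩) = prefixCut HX q i 0 := by
  have hw := i.2
  ext j
  rcases j with p | ⟨i', c⟩
  · by_cases hp : p ∈ Set.range (q i)
    · obtain ⟨a, rfl⟩ := hp
      simp only [splitHX, prefixCut, Sum.elim_inl, prefixVec_apply_q hinj, (hinj i).eq_iff,
        Fin.ext_iff]
      congr 1
      apply propext
      omega
    · have : ∀ a, p ≠ q i a := fun a h => hp ⟨a, h.symm⟩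
      simp [splitHX, prefixCut, prefixVec_apply_of_notMem i _ hp, this]
  · simp [splitHX, prefixCut, hr]

theorem splitHX_middle (hinj : ∀ i, Function.Injective (q i))
    (i : {i : Fin nX // 4 ≤ wt (HX i)}) (r : Fin (wt (HX i.1) - 2)) (n : ℕ) (hr : r.val = n + 1)
    (hn : n + 1 < wt (HX i.1) - 3) :
    splitHX HX q (Sum.inr ⟨i, r⟩) = prefixCut HX q i n + prefixCut HX q i (n + 1) := by
  have hw := i.2
  ext j
  rcases j with p | ⟨i', c⟩
  · by_cases hp : p ∈ Set.range (q i)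
    · obtain ⟨a, rfl⟩ := hp
      simp only [splitHX, prefixCut, Sum.elim_inl, prefixVec_apply_q hinj, (hinj i).eq_iff,
        Fin.ext_iff, Pi.add_apply]
      split_ifs <;> first | omega | rfl
    · have : ∀ a, p ≠ q i a := fun a h => hp ⟨a, h.symm⟩
      simp [splitHX, prefixCut, prefixVec_apply_of_notMem i _ hp, this]
  · simp only [splitHX, prefixCut, Sum.elim_inr, Pi.add_apply, hr]
    by_cases h : i' = i
    · simp only [h, true_and]
      split_ifs <;> first | omega | rfl
    · simp [h]

theorem splitHX_last (hinj : ∀ i, Function.Injective (q i))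
    (hrange : ∀ i p, HX i.1 p ≠ 0 ↔ p ∈ Set.range (q i))
    (i : {i : Fin nX // 4 ≤ wt (HX i)}) (r : Fin (wt (HX i.1) - 2))
    (hr : r.val = wt (HX i.1) - 3) :
    splitHX HX q (Sum.inr ⟨i, r⟩) =
      prefixCut HX q i (wt (HX i.1) - 4) + Sum.elim (HX i.1) 0 := by
  have hw := i.2
  ext j
  rcases j with p | ⟨i', c⟩
  · by_cases hp : p ∈ Set.range (q i)
    · obtain ⟨a, rfl⟩ := hp
      have := a.isLt
      simp only [splitHX, prefixCut, Sum.elim_inl, prefixVec_apply_q hinj, (hinj i).eq_iff,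
        Fin.ext_iff, Pi.add_apply, heavyRow_apply_q hrange]
      split_ifs <;> first | omega | rfl
    · have : ∀ a, p ≠ q i a := fun a h => hp ⟨a, h.symm⟩
      have h0 : HX i.1 p = 0 := not_not.1 fun h => hp ((hrange i p).1 h)
      simp [splitHX, prefixCut, prefixVec_apply_of_notMem i _ hp, this, h0]
  · have := c.isLt
    simp only [splitHX, prefixCut, Sum.elim_inr, Pi.add_apply, hr, Pi.zero_apply, add_zero]
    by_cases h : i' = i
    · subst h
      simp only [true_and]
      split_ifs <;> first | omega | rfl
    · simp [h]

theorem prefixCut_mem_span (hinj : ∀ i, Function.Injective (q i))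
    (i : {i : Fin nX // 4 ≤ wt (HX i)}) (n : ℕ) (hn : n < wt (HX i.1) - 3) :
    prefixCut HX q i n ∈ Submodule.span (ZMod 2) (Set.range (splitHX HX q)) := by
  induction n with
  | zero =>
    rw [← splitHX_first hinj i ⟨0, by omega⟩ rfl]
    exact Submodule.subset_span ⟨_, rfl⟩
  | succ n ih =>
    have h := splitHX_middle hinj i ⟨n + 1, by omega⟩ n rfl hn
    rw [← Submodule.add_mem_iff_right _ (ih (by omega)), ← h]
    exact Submodule.subset_span ⟨_, rfl⟩

theorem cutMatrix_mulVec_prefixCut (i : {i : Fin nX // 4 ≤ wt (HX i)}) (n : ℕ)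
    (hn : n < wt (HX i.1) - 3) : cutMatrix HX q *ᵥ prefixCut HX q i n = 0 := by
  rw [cutMatrix_mulVec, Finset.sum_eq_single ⟨i, ⟨n, hn⟩⟩]
  · ext p
    simp [prefixCut, CharTwo.add_self_eq_zero]
  · rintro ⟨i', c⟩ _ h
    have : ¬ (i' = i ∧ c.val = n) := by
      rintro ⟨rfl, rfl⟩
      exact h rfl
    simp [prefixCut, this]
  · simp

theorem elim_mem_span (hinj : ∀ i, Function.Injective (q i))
    (hrange : ∀ i p, HX i.1 p ≠ 0 ↔ p ∈ Set.range (q i)) {u : Fin N → ZMod 2}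
    (hu : u ∈ Submodule.span (ZMod 2) (Set.range HX)) :
    (Sum.elim u 0 : SplitQ HX → ZMod 2) ∈
      Submodule.span (ZMod 2) (Set.range (splitHX HX q)) := by
  induction hu using Submodule.span_induction with
  | mem u hu =>
    obtain ⟨i, rfl⟩ := hu
    by_cases hi : 4 ≤ wt (HX i)
    · have h := splitHX_last hinj hrange ⟨i, hi⟩ ⟨wt (HX i) - 3, by simp only; omega⟩ rfl
      rw [← Submodule.add_mem_iff_right _
        (prefixCut_mem_span hinj ⟨i, hi⟩ (wt (HX i) - 4) (by simp only; omega)), ← h]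
      exact Submodule.subset_span ⟨_, rfl⟩
    · refine Submodule.subset_span ⟨Sum.inl ⟨i, hi⟩, ?_⟩
      ext j
      rcases j with p | x <;> simp [splitHX]
  | zero => simp
  | add u v _ _ hu hv =>
    convert add_mem hu hv using 1
    ext j
    rcases j with p | x <;> simp
  | smul c u _ hu =>
    convert Submodule.smul_mem _ c hu using 1
    ext j
    rcases j with p | x <;> simp

/-- The row space of the split code is the preimage of the row space of the original one. -/
theorem span_splitHX (hinj : ∀ i, Function.Injective (q i))
    (hrange : ∀ i p, HX i.1 p ≠ 0 ↔ p ∈ Set.range (q i)) :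
    Submodule.span (ZMod 2) (Set.range (splitHX HX q)) =
      (Submodule.span (ZMod 2) (Set.range HX)).comap (cutMatrix HX q).mulVecLin := by
  apply le_antisymm
  · rw [Submodule.span_le]
    rintro _ ⟨i | ⟨i, r⟩, rfl⟩
    · have : cutMatrix HX q *ᵥ splitHX HX q (Sum.inl i) = HX i.1 := by
        rw [cutMatrix_mulVec]
        ext p
        simp [splitHX]
      simpa [this] using Submodule.subset_span (Set.mem_range_self i.1)
    · have hr := r.isLt
      have hw := i.2
      simp only [SetLike.mem_coe, Submodule.mem_comap, mulVecLin_apply]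
      rcases Nat.eq_zero_or_pos r.val with h | h
      · rw [splitHX_first hinj i r h, cutMatrix_mulVec_prefixCut i 0 (by omega)]
        exact zero_mem _
      by_cases h' : r.val = wt (HX i.1) - 3
      · have : cutMatrix HX q *ᵥ Sum.elim (HX i.1) 0 = HX i.1 := by
          rw [cutMatrix_mulVec]
          ext p
          simp
        rw [splitHX_last hinj hrange i r h', mulVec_add,
          cutMatrix_mulVec_prefixCut i _ (by omega), zero_add, this]
        exact Submodule.subset_span ⟨_, rfl⟩
      · rw [splitHX_middle hinj i r (r.val - 1) (by omega) (by omega), mulVec_add,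
          cutMatrix_mulVec_prefixCut i _ (by omega),
          cutMatrix_mulVec_prefixCut i _ (by omega), add_zero]
        exact zero_mem _
  · intro v hv
    have hv' := elim_mem_span hinj hrange (Submodule.mem_comap.1 hv)
    have : v = Sum.elim (cutMatrix HX q *ᵥ v) 0 +
        ∑ x : Σ i : {i : Fin nX // 4 ≤ wt (HX i)}, Fin (wt (HX i.1) - 3),
          v (Sum.inr x) • prefixCut HX q x.1 x.2 := by
      ext j
      rcases j with p | ⟨i, c⟩
      · simp [cutMatrix_mulVec, prefixCut, add_assoc, CharTwo.add_self_eq_zero]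
      · rw [Pi.add_apply, Finset.sum_apply, Finset.sum_eq_single ⟨i, c⟩]
        · simp [prefixCut]
        · rintro ⟨i', c'⟩ _ h
          have : ¬ (i = i' ∧ c.val = c'.val) := by
            rintro ⟨rfl, h'⟩
            exact h (by rw [Fin.ext h'])
          simp [prefixCut, this]
        · simp
    rw [this]
    exact add_mem hv' (sum_mem fun x _ =>
      Submodule.smul_mem _ _ (prefixCut_mem_span hinj x.1 x.2 x.2.isLt))

/-- Modulo the row space, every qubit of the split code stands for a low-weight vector. -/
theorem exists_wt_le_of_qubit
    (hrange : ∀ i p, HX i.1 p ≠ 0 ↔ p ∈ Set.range (q i)) (j : SplitQ HX) :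
    ∃ b : Fin N → ZMod 2, wt b ≤ (maxRowW HX + 1) / 2 + 1 ∧
      (cutMatrix HX q).col j - b ∈ Submodule.span (ZMod 2) (Set.range HX) := by
  rcases j with p | ⟨i, m⟩
  · refine ⟨(cutMatrix HX q).col (Sum.inl p), ?_, by simp⟩
    have hcol : (cutMatrix HX q).col (Sum.inl p) = Pi.single p 1 := by
      ext p'
      simp [cutMatrix, one_apply, Pi.single_apply]
    have : wt (Pi.single p 1 : Fin N → ZMod 2) = 1 := by
      simp [wt, Pi.single_apply, Finset.filter_eq']
    rw [hcol]
    omega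
  · have hcol : (cutMatrix HX q).col (Sum.inr ⟨i, m⟩) = prefixVec HX q i m := by
      ext p
      simp [cutMatrix]
    have hle : wt (HX i.1) ≤ maxRowW HX :=
      Finset.le_sup (f := fun i => wt (HX i)) (Finset.mem_univ i.1)
    have hsum := wt_add_wt_sub_le (prefixVec HX q i m) (HX i.1) fun p hp => by
      have hp' : p ∈ Set.range (q i) := not_not.1 fun h => hp (prefixVec_apply_of_notMem i m h)
      obtain ⟨a, rfl⟩ := hp'
      rw [heavyRow_apply_q hrange]
      exact Fin.eq_one_of_ne_zero _ hp
    rw [hcol]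
    by_cases h : wt (prefixVec HX q i m) ≤ (maxRowW HX + 1) / 2 + 1
    · exact ⟨_, h, by simp⟩
    · refine ⟨HX i.1 - prefixVec HX q i m, by omega, ?_⟩
      have : prefixVec HX q i m - (HX i.1 - prefixVec HX q i m) = HX i.1 := by
        ext p
        simp only [Pi.sub_apply]
        generalize prefixVec HX q i m p = a
        generalize HX i.1 p = b
        revert a b
        decide
      rw [this]
      exact Submodule.subset_span ⟨_, rfl⟩

theorem rank_splitHX (hinj : ∀ i, Function.Injective (q i))
    (hrange : ∀ i p, HX i.1 p ≠ 0 ↔ p ∈ Set.range (q i)) :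
    (splitHX HX q).rank + N = HX.rank + Fintype.card (SplitQ HX) := by
  have hsurj := cutMatrix_mulVec_surjective HX q
  have h := (cutMatrix HX q).mulVecLin.finrank_range_add_finrank_ker
  set S := Submodule.span (ZMod 2) (Set.range HX) with hS
  set T := S.comap (cutMatrix HX q).mulVecLin with hT
  have h' := ((cutMatrix HX q).mulVecLin.domRestrict T).finrank_range_add_finrank_ker
  have hker : Module.finrank (ZMod 2) ((cutMatrix HX q).mulVecLin.domRestrict T).ker =
      Module.finrank (ZMod 2) (cutMatrix HX q).mulVecLin.ker := by
    rw [LinearMap.ker_domRestrict]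
    exact (Submodule.comapSubtypeEquivOfLe (LinearMap.ker_le_comap _)).finrank_eq
  rw [LinearMap.range_domRestrict, hT, Submodule.map_comap_eq_of_surjective hsurj, ← hT,
    hker] at h'
  rw [LinearMap.range_eq_top.2 hsurj, finrank_top] at h
  simp only [Module.finrank_fintype_fun_eq_card, Fintype.card_fin] at h
  have e1 : (splitHX HX q).rank = Module.finrank (ZMod 2) T := by
    rw [rank_eq_finrank_span_row, hT, hS, ← span_splitHX hinj hrange]
    rfl
  have e2 : HX.rank = Module.finrank (ZMod 2) S := rank_eq_finrank_span_row _
  omega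

end Rows

theorem rank_splitHZ (HX : Matrix (Fin nX) (Fin N) (ZMod 2))
    (HZ : Matrix (Fin nZ) (Fin N) (ZMod 2))
    (q : ∀ i : {i : Fin nX // 4 ≤ wt (HX i)}, Fin (wt (HX i.1)) → Fin N) :
    (splitHZ HX HZ q).rank = HZ.rank := by
  rw [splitHZ_eq_mul, Matrix.rank, Matrix.rank, mulVecLin_mul,
    LinearMap.range_comp_of_range_eq_top _
      (LinearMap.range_eq_top.2 (cutMatrix_mulVec_surjective HX q))]

/-- If `K ≥ 1`, the full X-type generator splitting procedure preserves
the number of logical qubits, `K̃ = K ≥ 1`, and its X-distance satisfies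
`d̃_X · (⌈w_X/2⌉ + 1) ≥ d_X`. -/
theorem stmt4 (HX : Matrix (Fin nX) (Fin N) (ZMod 2)) (HZ : Matrix (Fin nZ) (Fin N) (ZMod 2))
    (hCSS : HX * HZ.transpose = 0)
    (q : ∀ i : {i : Fin nX // 4 ≤ wt (HX i)}, Fin (wt (HX i.1)) → Fin N)
    (hinj : ∀ i, Function.Injective (q i))
    (hrange : ∀ i p, HX i.1 p ≠ 0 ↔ p ∈ Set.range (q i))
    (hK : 1 ≤ N - HX.rank - HZ.rank) :
    (Fintype.card (SplitQ HX) - (splitHX HX q).rank - (splitHZ HX HZ q).rank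
        = N - HX.rank - HZ.rank) ∧
    distX HX HZ ≤ distX (splitHX HX q) (splitHZ HX HZ q) * ((maxRowW HX + 1) / 2 + 1) := by
  refine ⟨?_, ?_⟩
  · have h1 := rank_splitHX hinj hrange
    rw [rank_splitHZ]
    omega
  · rcases Nat.eq_zero_or_pos (distX HX HZ) with h0 | hpos
    · rw [h0]
      exact Nat.zero_le _
    obtain ⟨_, u, hu, hu', -⟩ := Nat.nonempty_of_pos_sInf hpos
    obtain ⟨u, rfl⟩ := cutMatrix_mulVec_surjective HX q u
    obtain ⟨v, hv, hv', hd⟩ := Nat.sInf_mem (s := {k | ∃ v : SplitQ HX → ZMod 2,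
      (splitHZ HX HZ q).mulVec v = 0 ∧
      v ∉ Submodule.span (ZMod 2) (Set.range (splitHX HX q)) ∧ wt v = k})
      ⟨wt u, u, by rwa [splitHZ_eq_mul, ← mulVec_mulVec], by rwa [span_splitHX hinj hrange], rfl⟩
    rw [span_splitHX hinj hrange, Submodule.mem_comap, mulVecLin_apply] at hv'
    rw [splitHZ_eq_mul, ← mulVec_mulVec] at hv
    choose b hb hbS using exists_wt_le_of_qubit hrange
    have hdiff : cutMatrix HX q *ᵥ v - ∑ j, v j • b j ∈
        Submodule.span (ZMod 2) (Set.range HX) := by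
      have : cutMatrix HX q *ᵥ v = ∑ j, v j • (cutMatrix HX q).col j := by
        ext p
        simp [mulVec, dotProduct, mul_comm]
      rw [this, ← Finset.sum_sub_distrib]
      simp only [← smul_sub]
      exact sum_mem fun j _ => Submodule.smul_mem _ _ (hbS j)
    have hker : ∀ x ∈ Submodule.span (ZMod 2) (Set.range HX), HZ *ᵥ x = 0 := by
      intro x hx
      have hle : Submodule.span (ZMod 2) (Set.range HX) ≤ HZ.mulVecLin.ker := by
        rw [Submodule.span_le]
        rintro _ ⟨i, rfl⟩
        ext R
        simpa [mul_apply, mulVec, dotProduct, mul_comm] using congrFun (congrFun hCSS i) R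
      exact hle hx
    have hbK : HZ *ᵥ (∑ j, v j • b j) = 0 := by
      have := hker _ hdiff
      rwa [mulVec_sub, hv, zero_sub, neg_eq_zero] at this
    have hbN : ∑ j, v j • b j ∉ Submodule.span (ZMod 2) (Set.range HX) := fun h =>
      hv' ((Submodule.sub_mem_iff_left _ h).1 hdiff)
    calc distX HX HZ ≤ wt (∑ j, v j • b j) := Nat.sInf_le ⟨_, hbK, hbN, rfl⟩
      _ ≤ wt v * ((maxRowW HX + 1) / 2 + 1) := wt_sum_smul_le v b _ hb
      _ = _ := by rw [hd, distX]
end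

section
/- Let c ≥ 2 and let C be a CSS code with w_X, w_Z, q_X, q_Z ≤ c. Then for every integer l ≥ 2 and every choice function κ, the thickened code C̃ satisfies: Ñ = N·l + n_X·(l−1); w̃_X ≤ c+2; w̃_Z ≤ c+2; q̃_X ≤ c; q̃_Z ≤ c+2; K̃ = K; and, if K ≥ 1, d̃_X = l·d_X and d̃_Z = d_Z. -/
open Matrix

variable {N nX nZ : ℕ}

/-- Qubits of the thickened code: qubits `(q,k)` for `q` a qubit of `C` and `k ∈ {1,…,l}`
(0-indexed below), together with qubits `[s,k]` for `s` a row of `H_X` and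
`k ∈ {1,…,l−1}`. -/
abbrev TQubit (N nX l : ℕ) : Type := (Fin N × Fin l) ⊕ (Fin nX × Fin (l - 1))

/-- Row index type of the Z-type generator matrix of the thickened code: one generator for
each row of `H_Z` (type (i)), and one for each pair of a qubit `q` of `C` and
`k ∈ {1,…,l−1}` (type (ii)). -/
abbrev TZIdx (N nZ l : ℕ) : Type := Fin nZ ⊕ (Fin N × Fin (l - 1))

/-- X-type generator matrix of the thickened code: for each row `s` of `HX` with support
`{q₁,…,q_w}` and each `k ∈ {1,…,l}` (0-indexed here), one generator with support
`{(q₁,k),…,(q_w,k)} ∪ {[s,k−1],[s,k]}` (with `[s,0]`, `[s,l]` omitted at the ends). -/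
def thickHX (HX : Matrix (Fin nX) (Fin N) (ZMod 2)) (l : ℕ) :
    Matrix (Fin nX × Fin l) (TQubit N nX l) (ZMod 2) := fun s j =>
  match s, j with
  | (s, k), Sum.inl (p, k') => if k' = k then HX s p else 0
  | (s, k), Sum.inr (s', k') =>
      if s' = s ∧ ((k'.val = k.val) ∨ (k'.val + 1 = k.val)) then 1 else 0

/-- Z-type generator matrix of the thickened code with choice function `κ`:
(i) for each row `r` of `HZ` with support `{q₁,…,q_w}`, one generator with support
`{(q₁,κ(r)),…,(q_w,κ(r))}`; (ii) for each qubit `q` of `C` and each `k ∈ {1,…,l−1}`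
(0-indexed here), one generator with support
`{(q,k),(q,k+1)} ∪ {[s,k] : row s of HX acts on q}`. -/
def thickHZ (HX : Matrix (Fin nX) (Fin N) (ZMod 2)) (HZ : Matrix (Fin nZ) (Fin N) (ZMod 2))
    (l : ℕ) (κ : Fin nZ → Fin l) :
    Matrix (TZIdx N nZ l) (TQubit N nX l) (ZMod 2) := fun r j =>
  match r, j with
  | Sum.inl R, Sum.inl (p, k) => if k = κ R then HZ R p else 0
  | Sum.inl _, Sum.inr _ => 0
  | Sum.inr (p, k), Sum.inl (p', k') =>
      if p' = p ∧ ((k'.val = k.val) ∨ (k'.val = k.val + 1)) then 1 else 0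
  | Sum.inr (p, k), Sum.inr (s, k') => if k'.val = k.val then HX s p else 0

section Padding

/-- Shift a finite sequence by one place and pad it with zeros on both sides. -/
def pad {n : ℕ} (x : Fin n → ZMod 2) : ℕ → ZMod 2
  | 0 => 0
  | i + 1 => if h : i < n then x ⟨i, h⟩ else 0

lemma sum_ite_val_eq {n : ℕ} (x : Fin n → ZMod 2) (j : ℕ) :
    ∑ i : Fin n, (if i.val = j then x i else 0) = pad x (j + 1) := by
  by_cases h : j < n
  · rw [Finset.sum_eq_single ⟨j, h⟩]
    · simp [pad, h]
    · intro b _ hb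
      rw [if_neg fun hh => hb (Fin.ext hh)]
    · simp
  · rw [Finset.sum_eq_zero]
    · simp [pad, h]
    · intro i _
      rw [if_neg (by omega)]

lemma sum_ite_val_or_eq {n : ℕ} (x : Fin n → ZMod 2) (k : ℕ) :
    ∑ i : Fin n, (if i.val = k ∨ i.val + 1 = k then x i else 0) = pad x k + pad x (k + 1) := by
  have hsplit : ∀ i : Fin n, (if i.val = k ∨ i.val + 1 = k then x i else 0) =
      (if i.val + 1 = k then x i else 0) + (if i.val = k then x i else 0) := by
    intro i
    split_ifs <;> first | omega | simp
  simp_rw [hsplit, Finset.sum_add_distrib, sum_ite_val_eq]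
  congr 1
  cases k with
  | zero => simp [pad]
  | succ j => simp only [add_left_inj, sum_ite_val_eq]

lemma sum_ite_val_or_eq_succ {n : ℕ} (y : Fin n → ZMod 2) (k : ℕ) (hk : k + 1 < n) :
    ∑ i : Fin n, (if i.val = k ∨ i.val = k + 1 then y i else 0) =
      y ⟨k, by omega⟩ + y ⟨k + 1, hk⟩ := by
  have hsplit : ∀ i : Fin n, (if i.val = k ∨ i.val = k + 1 then y i else 0) =
      (if i.val = k then y i else 0) + (if i.val = k + 1 then y i else 0) := by
    intro i
    split_ifs <;> first | omega | simp
  simp_rw [hsplit, Finset.sum_add_distrib, sum_ite_val_eq]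
  simp [pad, hk, show k < n by omega]

/-- The sequence of the proper partial sums of a finite sequence. -/
def partialSum {l : ℕ} (y : Fin l → ZMod 2) (i : ℕ) : ZMod 2 :=
  ∑ j : Fin l, if j.val < i then y j else 0

lemma partialSum_zero {l : ℕ} (y : Fin l → ZMod 2) : partialSum y 0 = 0 := by
  simp [partialSum]

lemma partialSum_self {l : ℕ} (y : Fin l → ZMod 2) : partialSum y l = ∑ j, y j := by
  simp [partialSum]

lemma partialSum_succ {l : ℕ} (y : Fin l → ZMod 2) (k : Fin l) :
    partialSum y (k + 1) = partialSum y k + y k := by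
  have h := sum_ite_val_eq y k
  simp only [pad, k.isLt, dite_true] at h
  rw [partialSum, partialSum, ← h, ← Finset.sum_add_distrib]
  refine Finset.sum_congr rfl fun j _ => ?_
  split_ifs <;> first | omega | simp

lemma pad_partialSum {l : ℕ} (y : Fin l → ZMod 2) (hy : ∑ j, y j = 0) {i : ℕ} (hi : i ≤ l) :
    pad (fun k : Fin (l - 1) => partialSum y (k + 1)) i = partialSum y i := by
  cases i with
  | zero => simp [pad, partialSum_zero]
  | succ j =>
    by_cases h : j < l - 1
    · simp [pad, h]
    · have : j + 1 = l := by omega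
      simp only [pad, h, dite_false]
      rw [this, partialSum_self, hy]

lemma pad_partialSum_add {l : ℕ} (y : Fin l → ZMod 2) (hy : ∑ j, y j = 0) (k : Fin l) :
    pad (fun k : Fin (l - 1) => partialSum y (k + 1)) k +
      pad (fun k : Fin (l - 1) => partialSum y (k + 1)) (k + 1) = y k := by
  rw [pad_partialSum y hy k.isLt.le, pad_partialSum y hy k.isLt, partialSum_succ]
  linear_combination CharTwo.add_self_eq_zero (partialSum y k)

lemma pad_eq_partialSum {l : ℕ} {x : Fin (l - 1) → ZMod 2} {y : Fin l → ZMod 2}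
    (h : ∀ k : Fin l, pad x k + pad x (k + 1) = y k) :
    ∀ i ≤ l, pad x i = partialSum y i := by
  intro i
  induction i with
  | zero => simp [pad, partialSum_zero]
  | succ j ih =>
    intro hj
    have := partialSum_succ y ⟨j, hj⟩
    simp only at this
    rw [this, ← ih (by omega), ← h ⟨j, hj⟩]
    linear_combination -CharTwo.add_self_eq_zero (pad x j)

lemma sum_eq_zero_of_pad_add {l : ℕ} {x : Fin (l - 1) → ZMod 2} {y : Fin l → ZMod 2}
    (h : ∀ k : Fin l, pad x k + pad x (k + 1) = y k) : ∑ k, y k = 0 := by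
  rw [← partialSum_self, ← pad_eq_partialSum h l le_rfl]
  cases l <;> simp [pad]

lemma eq_partialSum_of_pad_add {l : ℕ} {x : Fin (l - 1) → ZMod 2} {y : Fin l → ZMod 2}
    (h : ∀ k : Fin l, pad x k + pad x (k + 1) = y k) (k : Fin (l - 1)) :
    x k = partialSum y (k + 1) := by
  rw [← pad_eq_partialSum h (k + 1) (by omega)]
  simp [pad]

lemma sum_mul_partialSum {ι : Type*} [Fintype ι] {l : ℕ} (c : ι → ZMod 2)
    (y : ι → Fin l → ZMod 2) (i : ℕ) :
    ∑ p, c p * partialSum (y p) i = partialSum (fun j => ∑ p, c p * y p j) i := by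
  simp only [partialSum, Finset.mul_sum]
  rw [Finset.sum_comm]
  refine Finset.sum_congr rfl fun j _ => ?_
  split_ifs <;> simp

end Padding

section Products

variable (HX : Matrix (Fin nX) (Fin N) (ZMod 2)) (HZ : Matrix (Fin nZ) (Fin N) (ZMod 2)) {l : ℕ}

lemma thickHX_mulVec (v : TQubit N nX l → ZMod 2) (s : Fin nX) (k : Fin l) :
    (thickHX HX l *ᵥ v) (s, k) = ∑ p, HX s p * v (Sum.inl (p, k)) +
      (pad (fun i => v (Sum.inr (s, i))) k + pad (fun i => v (Sum.inr (s, i))) (k + 1)) := by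
  rw [← sum_ite_val_or_eq]
  simp only [mulVec, dotProduct, Fintype.sum_sum_type, Fintype.sum_prod_type, thickHX]
  congr 1
  · simp
  · rw [Finset.sum_eq_single s]
    · simp
    · intro b _ hb
      simp [hb]
    · simp

lemma thickHX_vecMul_inl (a : Fin nX × Fin l → ZMod 2) (p : Fin N) (k : Fin l) :
    (a ᵥ* thickHX HX l) (Sum.inl (p, k)) = ∑ s, a (s, k) * HX s p := by
  simp [vecMul, dotProduct, Fintype.sum_prod_type, thickHX]

lemma thickHX_vecMul_inr (a : Fin nX × Fin l → ZMod 2) (s : Fin nX) (k : Fin (l - 1)) :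
    (a ᵥ* thickHX HX l) (Sum.inr (s, k)) =
      a (s, ⟨k, by omega⟩) + a (s, ⟨k + 1, by omega⟩) := by
  rw [← sum_ite_val_or_eq_succ (fun i => a (s, i))]
  simp only [vecMul, dotProduct, Fintype.sum_prod_type, thickHX]
  rw [Finset.sum_eq_single s]
  · simp [eq_comm]
  · intro b _ hb
    simp [hb.symm]
  · simp

lemma thickHZ_mulVec_inl (κ : Fin nZ → Fin l) (v : TQubit N nX l → ZMod 2) (R : Fin nZ) :
    (thickHZ HX HZ l κ *ᵥ v) (Sum.inl R) = ∑ p, HZ R p * v (Sum.inl (p, κ R)) := by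
  simp [mulVec, dotProduct, Fintype.sum_prod_type, thickHZ]

lemma thickHZ_mulVec_inr (κ : Fin nZ → Fin l) (v : TQubit N nX l → ZMod 2) (p : Fin N)
    (k : Fin (l - 1)) :
    (thickHZ HX HZ l κ *ᵥ v) (Sum.inr (p, k)) =
      v (Sum.inl (p, ⟨k, by omega⟩)) + v (Sum.inl (p, ⟨k + 1, by omega⟩)) +
        ∑ s, HX s p * v (Sum.inr (s, k)) := by
  rw [← sum_ite_val_or_eq_succ (fun i => v (Sum.inl (p, i)))]
  simp only [mulVec, dotProduct, Fintype.sum_sum_type, Fintype.sum_prod_type, thickHZ]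
  congr 1
  · rw [Finset.sum_eq_single p]
    · simp
    · intro b _ hb
      simp [hb]
    · simp
  · simp [Fin.val_inj]

/-- The contribution to layer `k` of the combination of type (i) generators with
coefficients `b`. -/
def layerSum (κ : Fin nZ → Fin l) (b : Fin nZ → ZMod 2) (p : Fin N) (k : Fin l) : ZMod 2 :=
  ∑ R, b R * (if k = κ R then HZ R p else 0)

lemma sum_layerSum (κ : Fin nZ → Fin l) (b : Fin nZ → ZMod 2) (p : Fin N) :
    ∑ k, layerSum HZ κ b p k = (b ᵥ* HZ) p := by
  simp only [layerSum, vecMul, dotProduct]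
  rw [Finset.sum_comm]
  simp

lemma thickHZ_vecMul_inl (κ : Fin nZ → Fin l) (b : TZIdx N nZ l → ZMod 2) (p : Fin N)
    (k : Fin l) :
    (b ᵥ* thickHZ HX HZ l κ) (Sum.inl (p, k)) = layerSum HZ κ (fun R => b (Sum.inl R)) p k +
      (pad (fun i => b (Sum.inr (p, i))) k + pad (fun i => b (Sum.inr (p, i))) (k + 1)) := by
  rw [← sum_ite_val_or_eq]
  simp only [vecMul, dotProduct, Fintype.sum_sum_type, Fintype.sum_prod_type, thickHZ, layerSum]
  congr 1
  rw [Finset.sum_eq_single p]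
  · simp [eq_comm]
  · intro b _ hb
    simp [hb.symm]
  · simp

lemma thickHZ_vecMul_inr (κ : Fin nZ → Fin l) (b : TZIdx N nZ l → ZMod 2) (s : Fin nX)
    (k : Fin (l - 1)) :
    (b ᵥ* thickHZ HX HZ l κ) (Sum.inr (s, k)) = ∑ p, HX s p * b (Sum.inr (p, k)) := by
  simp [vecMul, dotProduct, Fintype.sum_prod_type, thickHZ, Fin.val_inj, mul_comm]

variable {HX HZ}

lemma sum_mul_layerSum (hCSS : HX * HZ.transpose = 0) (κ : Fin nZ → Fin l)
    (b : Fin nZ → ZMod 2) (s : Fin nX) (k : Fin l) :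
    ∑ p, HX s p * layerSum HZ κ b p k = 0 := by
  simp only [layerSum, Finset.mul_sum]
  rw [Finset.sum_comm]
  refine Finset.sum_eq_zero fun R _ => ?_
  have h : ∑ p, HX s p * HZ R p = 0 := by
    simpa [Matrix.mul_apply] using congrFun (congrFun hCSS s) R
  split_ifs
  · calc ∑ p, HX s p * (b R * HZ R p) = b R * ∑ p, HX s p * HZ R p := by
          rw [Finset.mul_sum]
          exact Finset.sum_congr rfl fun p _ => by ring
      _ = 0 := by rw [h, mul_zero]
  · simp

end Products

section Weights

lemma wt_eq_sum {α : Type*} [Fintype α] (v : α → ZMod 2) :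
    wt v = ∑ j, if v j ≠ 0 then 1 else 0 := by
  rw [wt, Finset.card_filter]

lemma wt_le_maxRowW {m α : Type*} [Fintype m] [Fintype α] (M : Matrix m α (ZMod 2)) (i : m) :
    wt (M i) ≤ maxRowW M :=
  Finset.le_sup (f := fun i => wt (M i)) (Finset.mem_univ i)

lemma wt_le_maxColW {m α : Type*} [Fintype m] [Fintype α] (M : Matrix m α (ZMod 2)) (j : α) :
    wt (fun i => M i j) ≤ maxColW M :=
  Finset.le_sup (f := fun j => wt fun i => M i j) (Finset.mem_univ j)

lemma wt_sum {α β : Type*} [Fintype α] [Fintype β] (v : α ⊕ β → ZMod 2) :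
    wt v = wt (fun a => v (Sum.inl a)) + wt (fun b => v (Sum.inr b)) := by
  simp only [wt_eq_sum, Fintype.sum_sum_type]

lemma wt_prod {α β : Type*} [Fintype α] [Fintype β] (v : α × β → ZMod 2) :
    wt v = ∑ b, wt (fun a => v (a, b)) := by
  simp only [wt_eq_sum, Fintype.sum_prod_type_right]

lemma wt_zero {α : Type*} [Fintype α] : wt (fun _ : α => (0 : ZMod 2)) = 0 := by
  simp [wt]

lemma wt_prod_eq_layer {α β : Type*} [Fintype α] [Fintype β] {v : α × β → ZMod 2} (b : β)
    (h : ∀ a, ∀ b' ≠ b, v (a, b') = 0) : wt v = wt (fun a => v (a, b)) := by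
  rw [wt_prod, Finset.sum_eq_single b]
  · intro b' _ hb
    simp only [h _ b' hb, wt_zero]
  · simp

lemma wt_le_two_of_val {α : Type*} [Fintype α] {n : ℕ} {v : α × Fin n → ZMod 2} (a : α) (i j : ℕ)
    (h : ∀ a' k, v (a', k) ≠ 0 → a' = a ∧ (k.val = i ∨ k.val = j)) : wt v ≤ 2 := by
  classical
  rw [wt, ← Finset.card_image_of_injOn (f := fun x : α × Fin n => x.2.val)]
  · refine (Finset.card_le_card ?_).trans (Finset.card_le_two (a := i) (b := j))
    intro x hx
    simp only [Finset.mem_image, Finset.mem_filter, Finset.mem_univ, true_and] at hx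
    obtain ⟨⟨a', k⟩, hv, rfl⟩ := hx
    simpa using (h a' k hv).2
  · rintro ⟨a₁, k₁⟩ h₁ ⟨a₂, k₂⟩ h₂ hk
    simp only [Finset.coe_filter, Finset.mem_univ, true_and, Set.mem_ofPred_eq] at h₁ h₂
    rw [(h _ _ h₁).1, (h _ _ h₂).1, Fin.ext (a := k₁) (b := k₂) hk]

lemma wt_mono {α : Type*} [Fintype α] {v w : α → ZMod 2} (h : ∀ a, v a ≠ 0 → w a ≠ 0) :
    wt v ≤ wt w :=
  Finset.card_le_card fun a ha => by
    simp only [Finset.mem_filter, Finset.mem_univ, true_and] at ha ⊢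
    exact h a ha

variable (HX : Matrix (Fin nX) (Fin N) (ZMod 2)) (HZ : Matrix (Fin nZ) (Fin N) (ZMod 2)) {l : ℕ}

lemma wt_thickHX_row (r : Fin nX × Fin l) : wt (thickHX HX l r) ≤ maxRowW HX + 2 := by
  obtain ⟨s, k⟩ := r
  rw [wt_sum]
  refine Nat.add_le_add ?_ (wt_le_two_of_val s k.val (k.val - 1) ?_)
  · rw [wt_prod_eq_layer k]
    · simpa [thickHX] using wt_le_maxRowW HX s
    · intro p k' hk
      simp [thickHX, hk]
  · intro s' k' h
    simp only [thickHX, ne_eq, ite_eq_right_iff, Classical.not_imp] at h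
    omega

lemma wt_thickHX_col (j : TQubit N nX l) :
    wt (fun r => thickHX HX l r j) ≤ max (maxColW HX) 2 := by
  rcases j with ⟨p, k⟩ | ⟨s, k⟩
  · refine le_max_of_le_left ?_
    rw [wt_prod_eq_layer k]
    · simpa [thickHX] using wt_le_maxColW HX p
    · intro s k' hk
      simp [thickHX, hk.symm]
  · refine le_max_of_le_right (wt_le_two_of_val s k.val (k.val + 1) ?_)
    intro s' k' h
    simp only [thickHX, ne_eq, ite_eq_right_iff, Classical.not_imp] at h
    omega

lemma wt_thickHZ_row (κ : Fin nZ → Fin l) (r : TZIdx N nZ l) :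
    wt (thickHZ HX HZ l κ r) ≤ max (maxRowW HZ) (maxColW HX + 2) := by
  rw [wt_sum]
  rcases r with R | ⟨p, k⟩
  · refine le_max_of_le_left ?_
    simp only [thickHZ, wt_zero, add_zero]
    rw [wt_prod_eq_layer (κ R)]
    · simpa using wt_le_maxRowW HZ R
    · intro p k' hk
      simp [hk]
  · refine le_max_of_le_right ?_
    rw [add_comm]
    refine Nat.add_le_add ?_ (wt_le_two_of_val p k.val (k.val + 1) ?_)
    · rw [wt_prod_eq_layer k]
      · simpa [thickHZ] using wt_le_maxColW HX p
      · intro s k' hk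
        simp [thickHZ, Fin.val_inj, hk]
    · intro p' k' h
      simp only [thickHZ, ne_eq, ite_eq_right_iff, Classical.not_imp] at h
      omega

lemma wt_thickHZ_col (κ : Fin nZ → Fin l) (j : TQubit N nX l) :
    wt (fun r => thickHZ HX HZ l κ r j) ≤ max (maxColW HZ + 2) (maxRowW HX) := by
  rw [wt_sum]
  rcases j with ⟨p, k⟩ | ⟨s, k⟩
  · refine le_max_of_le_left (Nat.add_le_add ?_ (wt_le_two_of_val p k.val (k.val - 1) ?_))
    · refine le_trans (wt_mono fun R => ?_) (wt_le_maxColW HZ p)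
      simp only [thickHZ, ne_eq, ite_eq_right_iff, Classical.not_imp]
      exact fun h => h.2
    · intro p' k' h
      simp only [thickHZ, ne_eq, ite_eq_right_iff, Classical.not_imp] at h
      omega
  · refine le_max_of_le_right ?_
    simp only [thickHZ, wt_zero, zero_add]
    rw [wt_prod_eq_layer k]
    · simpa using wt_le_maxRowW HX s
    · intro p k' hk
      simp [Fin.val_inj, hk.symm]

end Weights

section RowSpaces

lemma mem_span_range_iff_vecMul {m α : Type*} [Fintype m] (M : Matrix m α (ZMod 2))
    (v : α → ZMod 2) : v ∈ Submodule.span (ZMod 2) (Set.range M) ↔ ∃ a, a ᵥ* M = v := by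
  have h := range_vecMulLinear M
  rw [show Submodule.span (ZMod 2) (Set.range M) = LinearMap.range M.vecMulLinear from h.symm]
  rfl

lemma rank_add_finrank_ker_vecMul {m α : Type*} [Fintype m] [Fintype α]
    (M : Matrix m α (ZMod 2)) :
    M.rank + Module.finrank (ZMod 2) (LinearMap.ker M.vecMulLinear) = Fintype.card m := by
  classical
  rw [Matrix.rank_eq_finrank_span_row, ← range_vecMulLinear,
    LinearMap.finrank_range_add_finrank_ker, Module.finrank_fintype_fun_eq_card]

variable {HX : Matrix (Fin nX) (Fin N) (ZMod 2)} {HZ : Matrix (Fin nZ) (Fin N) (ZMod 2)} {l : ℕ}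
  {κ : Fin nZ → Fin l}

lemma partialSum_vecMul_eq_layer_add {v : TQubit N nX l → ZMod 2}
    (hv : thickHZ HX HZ l κ *ᵥ v = 0) (k : ℕ) (hk : k < l) :
    (fun s => partialSum (fun i => v (Sum.inr (s, i))) k) ᵥ* HX =
      fun p => v (Sum.inl (p, ⟨k, hk⟩)) + v (Sum.inl (p, ⟨0, by omega⟩)) := by
  induction k with
  | zero =>
    funext p
    simp [partialSum_zero, vecMul, dotProduct, CharTwo.add_self_eq_zero]
  | succ k ih =>
    have hk' : k < l - 1 := by omega
    funext p
    have h1 := congrFun (ih (by omega)) p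
    have h2 := congrFun hv (Sum.inr (p, ⟨k, hk'⟩))
    rw [thickHZ_mulVec_inr, Pi.zero_apply] at h2
    have hstep := fun s => partialSum_succ (fun i => v (Sum.inr (s, i))) (⟨k, hk'⟩ : Fin (l - 1))
    simp only at hstep
    simp only [vecMul, dotProduct] at h1 ⊢
    simp only [hstep, add_mul, Finset.sum_add_distrib, h1]
    simp only [mul_comm (HX _ p)] at h2
    linear_combination h2 - CharTwo.add_self_eq_zero (v (Sum.inl (p, ⟨k + 1, hk⟩)))

lemma layer_mem_span {v : TQubit N nX l → ZMod 2}
    (hv : v ∈ Submodule.span (ZMod 2) (Set.range (thickHX HX l))) (k : Fin l) :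
    (fun p => v (Sum.inl (p, k))) ∈ Submodule.span (ZMod 2) (Set.range HX) := by
  rw [mem_span_range_iff_vecMul] at hv ⊢
  obtain ⟨a, rfl⟩ := hv
  refine ⟨fun s => a (s, k), ?_⟩
  funext p
  rw [thickHX_vecMul_inl]
  rfl

lemma mem_span_thickHX {v : TQubit N nX l → ZMod 2} (hv : thickHZ HX HZ l κ *ᵥ v = 0)
    (k : Fin l)
    (hk : (fun p => v (Sum.inl (p, k))) ∈ Submodule.span (ZMod 2) (Set.range HX)) :
    v ∈ Submodule.span (ZMod 2) (Set.range (thickHX HX l)) := by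
  rw [mem_span_range_iff_vecMul] at hk ⊢
  obtain ⟨a, ha⟩ := hk
  have hlayer := fun i : Fin l => partialSum_vecMul_eq_layer_add hv i i.isLt
  refine ⟨fun x => a x.1 + (partialSum (fun i => v (Sum.inr (x.1, i))) k +
    partialSum (fun i => v (Sum.inr (x.1, i))) x.2), ?_⟩
  funext j
  rcases j with ⟨p, i⟩ | ⟨s, i⟩
  · rw [thickHX_vecMul_inl]
    have h1 := congrFun ha p
    have h2 := congrFun (hlayer k) p
    have h3 := congrFun (hlayer i) p
    simp only [vecMul, dotProduct] at h1 h2 h3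
    simp only [add_mul, Finset.sum_add_distrib, h1, h2, h3]
    linear_combination CharTwo.add_self_eq_zero (v (Sum.inl (p, k))) +
      CharTwo.add_self_eq_zero (v (Sum.inl (p, ⟨0, k.pos⟩)))
  · rw [thickHX_vecMul_inr]
    simp only [partialSum_succ]
    linear_combination CharTwo.add_self_eq_zero (a s) +
      CharTwo.add_self_eq_zero (partialSum (fun i => v (Sum.inr (s, i))) k) +
      CharTwo.add_self_eq_zero (partialSum (fun j => v (Sum.inr (s, j))) i)

lemma mulVec_vecMul_eq_zero (hCSS : HX * HZ.transpose = 0) (a : Fin nX → ZMod 2) :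
    HZ *ᵥ (a ᵥ* HX) = 0 := by
  rw [← vecMul_transpose, vecMul_vecMul, hCSS, vecMul_zero]

lemma layer_mem_ker (hCSS : HX * HZ.transpose = 0) {v : TQubit N nX l → ZMod 2}
    (hv : thickHZ HX HZ l κ *ᵥ v = 0) (k : Fin l) :
    HZ *ᵥ (fun p => v (Sum.inl (p, k))) = 0 := by
  funext R
  have hlayer : ∀ i : Fin l, ∑ p, HZ R p * v (Sum.inl (p, i)) =
      ∑ p, HZ R p * v (Sum.inl (p, ⟨0, k.pos⟩)) := by
    intro i
    have h := congrFun (mulVec_vecMul_eq_zero hCSS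
      (fun s => partialSum (fun j => v (Sum.inr (s, j))) i)) R
    rw [partialSum_vecMul_eq_layer_add hv i i.isLt] at h
    simp only [mulVec, dotProduct, mul_add, Finset.sum_add_distrib, Pi.zero_apply] at h
    exact CharTwo.add_eq_zero.mp h
  have hκ := congrFun hv (Sum.inl R)
  rw [thickHZ_mulVec_inl, hlayer] at hκ
  simp only [mulVec, dotProduct]
  rw [hlayer, hκ]
  rfl

lemma replicate_mem_ker {u : Fin N → ZMod 2} (hu : HZ *ᵥ u = 0) :
    thickHZ HX HZ l κ *ᵥ Sum.elim (fun x => u x.1) 0 = 0 := by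
  funext r
  rcases r with R | ⟨p, k⟩
  · rw [thickHZ_mulVec_inl]
    exact congrFun hu R
  · rw [thickHZ_mulVec_inr]
    simp [CharTwo.add_self_eq_zero]

lemma wt_replicate (u : Fin N → ZMod 2) :
    wt (Sum.elim (fun x => u x.1) 0 : TQubit N nX l → ZMod 2) = l * wt u := by
  rw [wt_sum, wt_prod]
  simp [wt_zero]

lemma project_mem_ker {v : TQubit N nX l → ZMod 2} (hv : thickHX HX l *ᵥ v = 0) :
    HX *ᵥ (fun p => ∑ k, v (Sum.inl (p, k))) = 0 := by
  funext s
  simp only [mulVec, dotProduct, Finset.mul_sum]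
  rw [Finset.sum_comm]
  refine sum_eq_zero_of_pad_add (x := fun i => v (Sum.inr (s, i))) fun k => ?_
  have h := congrFun hv (s, k)
  rw [thickHX_mulVec, Pi.zero_apply, CharTwo.add_eq_zero] at h
  exact h.symm

lemma project_mem_span {v : TQubit N nX l → ZMod 2}
    (hv : v ∈ Submodule.span (ZMod 2) (Set.range (thickHZ HX HZ l κ))) :
    (fun p => ∑ k, v (Sum.inl (p, k))) ∈ Submodule.span (ZMod 2) (Set.range HZ) := by
  rw [mem_span_range_iff_vecMul] at hv ⊢
  obtain ⟨b, rfl⟩ := hv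
  refine ⟨fun R => b (Sum.inl R), ?_⟩
  funext p
  simp only [thickHZ_vecMul_inl, Finset.sum_add_distrib (s := Finset.univ) (M := ZMod 2)
    (f := fun k => layerSum HZ κ (fun R => b (Sum.inl R)) p k), sum_layerSum]
  rw [sum_eq_zero_of_pad_add (x := fun i => b (Sum.inr (p, i))) fun k => rfl, add_zero]

lemma mem_span_thickHZ (hCSS : HX * HZ.transpose = 0) {v : TQubit N nX l → ZMod 2}
    (hv : thickHX HX l *ᵥ v = 0)
    (hproj : (fun p => ∑ k, v (Sum.inl (p, k))) ∈ Submodule.span (ZMod 2) (Set.range HZ)) :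
    v ∈ Submodule.span (ZMod 2) (Set.range (thickHZ HX HZ l κ)) := by
  rw [mem_span_range_iff_vecMul] at hproj ⊢
  obtain ⟨b, hb⟩ := hproj
  have hsum : ∀ p, ∑ k, (v (Sum.inl (p, k)) + layerSum HZ κ b p k) = 0 := by
    intro p
    rw [Finset.sum_add_distrib, sum_layerSum, hb]
    exact CharTwo.add_self_eq_zero _
  refine ⟨Sum.elim b fun x =>
    partialSum (fun k => v (Sum.inl (x.1, k)) + layerSum HZ κ b x.1 k) (x.2 + 1), ?_⟩
  funext j
  rcases j with ⟨p, k⟩ | ⟨s, k⟩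
  · rw [thickHZ_vecMul_inl]
    simp only [Sum.elim_inl, Sum.elim_inr]
    rw [pad_partialSum_add _ (hsum p)]
    linear_combination CharTwo.add_self_eq_zero (layerSum HZ κ b p k)
  · rw [thickHZ_vecMul_inr]
    simp only [Sum.elim_inr]
    rw [sum_mul_partialSum]
    simp only [mul_add, Finset.sum_add_distrib, sum_mul_layerSum hCSS, add_zero]
    refine (eq_partialSum_of_pad_add (x := fun i => v (Sum.inr (s, i))) (fun i => ?_) k).symm
    have h := congrFun hv (s, i)
    rw [thickHX_mulVec, Pi.zero_apply, CharTwo.add_eq_zero] at h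
    exact h.symm

lemma single_layer_mem_ker {u : Fin N → ZMod 2} (hu : HX *ᵥ u = 0) (k : Fin l) :
    thickHX HX l *ᵥ Sum.elim (fun x => if x.2 = k then u x.1 else 0) 0 = 0 := by
  funext ⟨s, i⟩
  have hpad : ∀ j, pad (fun _ : Fin (l - 1) => (0 : ZMod 2)) j = 0 := by
    intro j
    cases j <;> simp [pad]
  rw [thickHX_mulVec]
  simp only [Sum.elim_inl, Sum.elim_inr, Pi.zero_apply, hpad, add_zero]
  split_ifs
  · exact congrFun hu s
  · simp

lemma wt_single_layer (u : Fin N → ZMod 2) (k : Fin l) :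
    wt (Sum.elim (fun x => if x.2 = k then u x.1 else 0) 0 : TQubit N nX l → ZMod 2) = wt u := by
  rw [wt_sum, wt_prod_eq_layer k]
  · simp [wt_zero]
  · intro a b hb
    simp [hb]

lemma sum_wt_layer_le (v : TQubit N nX l → ZMod 2) :
    ∑ k, wt (fun p => v (Sum.inl (p, k))) ≤ wt v := by
  rw [wt_sum, wt_prod]
  exact Nat.le_add_right _ _

lemma wt_project_le (v : TQubit N nX l → ZMod 2) :
    wt (fun p => ∑ k, v (Sum.inl (p, k))) ≤ wt v := by
  refine le_trans ?_ (sum_wt_layer_le v)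
  simp only [wt_eq_sum]
  rw [Finset.sum_comm]
  refine Finset.sum_le_sum fun p _ => ?_
  split_ifs with h
  · obtain ⟨k, hk, hne⟩ := Finset.exists_ne_zero_of_sum_ne_zero h
    refine le_trans ?_ (Finset.single_le_sum (fun _ _ => Nat.zero_le _) hk)
    simp [hne]
  · exact Nat.zero_le _

end RowSpaces

section Distances

lemma sInf_eq_mul_sInf {S T : Set ℕ} (l : ℕ) (hST : ∀ x ∈ S, l * x ∈ T)
    (hTS : ∀ y ∈ T, ∃ x ∈ S, l * x ≤ y) : sInf T = l * sInf S := by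
  rcases S.eq_empty_or_nonempty with rfl | hS
  · have : T = ∅ := Set.eq_empty_of_forall_notMem fun y hy => by
      obtain ⟨x, hx, -⟩ := hTS y hy
      exact hx
    simp [this]
  · refine le_antisymm (Nat.sInf_le (hST _ (Nat.sInf_mem hS))) ?_
    obtain ⟨x, hx, hxy⟩ := hTS _ (Nat.sInf_mem ⟨_, hST _ (Nat.sInf_mem hS)⟩)
    exact (Nat.mul_le_mul_left l (Nat.sInf_le hx)).trans hxy

variable {HX : Matrix (Fin nX) (Fin N) (ZMod 2)} {HZ : Matrix (Fin nZ) (Fin N) (ZMod 2)} {l : ℕ}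

lemma distX_thick (hCSS : HX * HZ.transpose = 0) (hl : 0 < l) (κ : Fin nZ → Fin l) :
    distX (thickHX HX l) (thickHZ HX HZ l κ) = l * distX HX HZ := by
  refine sInf_eq_mul_sInf l ?_ ?_
  · rintro _ ⟨u, hu, hmem, rfl⟩
    refine ⟨_, replicate_mem_ker hu, fun h => hmem ?_, wt_replicate u⟩
    exact layer_mem_span h ⟨0, hl⟩
  · rintro _ ⟨v, hv, hmem, rfl⟩
    obtain ⟨k, -, hk⟩ := Finset.exists_min_image Finset.univ
      (fun k : Fin l => wt fun p => v (Sum.inl (p, k))) ⟨⟨0, hl⟩, Finset.mem_univ _⟩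
    refine ⟨_, ⟨fun p => v (Sum.inl (p, k)), layer_mem_ker hCSS hv k,
      fun h => hmem (mem_span_thickHX hv k h), rfl⟩, ?_⟩
    refine le_trans ?_ (sum_wt_layer_le v)
    simpa using Finset.card_nsmul_le_sum _ _ _ hk

lemma distZ_thick (hCSS : HX * HZ.transpose = 0) (hl : 0 < l) (κ : Fin nZ → Fin l) :
    distZ (thickHX HX l) (thickHZ HX HZ l κ) = distZ HX HZ := by
  rw [← one_mul (distZ HX HZ)]
  refine sInf_eq_mul_sInf 1 ?_ ?_
  · rintro _ ⟨u, hu, hmem, rfl⟩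
    rw [one_mul]
    refine ⟨_, single_layer_mem_ker hu ⟨0, hl⟩, fun h => hmem ?_, wt_single_layer u _⟩
    simpa using project_mem_span h
  · rintro _ ⟨v, hv, hmem, rfl⟩
    refine ⟨_, ⟨_, project_mem_ker hv, fun h => hmem (mem_span_thickHZ hCSS hv h), rfl⟩, ?_⟩
    rw [one_mul]
    exact wt_project_le v

end Distances

section Ranks

lemma finrank_ker_vecMul_eq {m m' α α' : Type*} [Fintype m] [Fintype m'] {M : Matrix m α (ZMod 2)}
    {M' : Matrix m' α' (ZMod 2)} (f : m → m')
    (hmap : ∀ a, a ᵥ* M' = 0 → (a ∘ f) ᵥ* M = 0)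
    (hinj : ∀ a, a ᵥ* M' = 0 → a ∘ f = 0 → a = 0)
    (hsurj : ∀ b, b ᵥ* M = 0 → ∃ a, a ᵥ* M' = 0 ∧ a ∘ f = b) :
    Module.finrank (ZMod 2) (LinearMap.ker M'.vecMulLinear) =
      Module.finrank (ZMod 2) (LinearMap.ker M.vecMulLinear) := by
  refine (LinearEquiv.ofBijective ((LinearMap.funLeft (ZMod 2) (ZMod 2) f).restrict
    (p := LinearMap.ker M'.vecMulLinear) (q := LinearMap.ker M.vecMulLinear) hmap)
    ⟨?_, ?_⟩).finrank_eq
  · rw [injective_iff_map_eq_zero]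
    rintro ⟨a, ha⟩ h
    exact Subtype.ext (hinj a ha (congrArg Subtype.val h))
  · rintro ⟨b, hb⟩
    obtain ⟨a, ha, hab⟩ := hsurj b hb
    exact ⟨⟨a, ha⟩, Subtype.ext hab⟩

variable {HX : Matrix (Fin nX) (Fin N) (ZMod 2)} {HZ : Matrix (Fin nZ) (Fin N) (ZMod 2)} {l : ℕ}

lemma eq_zeroth_layer_of_vecMul_eq_zero {a : Fin nX × Fin l → ZMod 2}
    (ha : a ᵥ* thickHX HX l = 0) (s : Fin nX) (k : ℕ) (hk : k < l) :
    a (s, ⟨k, hk⟩) = a (s, ⟨0, by omega⟩) := by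
  induction k with
  | zero => rfl
  | succ k ih =>
    rw [← ih (by omega)]
    have h := congrFun ha (Sum.inr (s, ⟨k, by omega⟩))
    rw [thickHX_vecMul_inr, Pi.zero_apply, CharTwo.add_eq_zero] at h
    exact h.symm

lemma rank_thickHX (hl : 0 < l) : (thickHX HX l).rank + nX = nX * l + HX.rank := by
  have h1 := rank_add_finrank_ker_vecMul (thickHX HX l)
  have h2 := rank_add_finrank_ker_vecMul HX
  rw [finrank_ker_vecMul_eq (M := HX) (fun s => (s, (⟨0, hl⟩ : Fin l)))] at h1
  · simp only [Fintype.card_prod, Fintype.card_fin] at h1 h2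
    omega
  · intro a ha
    funext p
    exact (thickHX_vecMul_inl HX a p ⟨0, hl⟩).symm.trans (congrFun ha _)
  · intro a ha h0
    funext ⟨s, k⟩
    exact (eq_zeroth_layer_of_vecMul_eq_zero ha s k k.isLt).trans (congrFun h0 s)
  · intro b hb
    refine ⟨fun x => b x.1, ?_, rfl⟩
    funext j
    rcases j with ⟨p, k⟩ | ⟨s, k⟩
    · rw [thickHX_vecMul_inl]
      exact congrFun hb p
    · rw [thickHX_vecMul_inr]
      exact CharTwo.add_self_eq_zero _

lemma pad_add_eq_layerSum {κ : Fin nZ → Fin l} {b : TZIdx N nZ l → ZMod 2}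
    (hb : b ᵥ* thickHZ HX HZ l κ = 0) (p : Fin N) (k : Fin l) :
    pad (fun i => b (Sum.inr (p, i))) k + pad (fun i => b (Sum.inr (p, i))) (k + 1) =
      layerSum HZ κ (fun R => b (Sum.inl R)) p k := by
  have h := congrFun hb (Sum.inl (p, k))
  rw [thickHZ_vecMul_inl, Pi.zero_apply, CharTwo.add_eq_zero] at h
  exact h.symm

lemma rank_thickHZ (hCSS : HX * HZ.transpose = 0) (κ : Fin nZ → Fin l) :
    (thickHZ HX HZ l κ).rank = N * (l - 1) + HZ.rank := by
  have h1 := rank_add_finrank_ker_vecMul (thickHZ HX HZ l κ)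
  have h2 := rank_add_finrank_ker_vecMul HZ
  rw [finrank_ker_vecMul_eq (M := HZ) Sum.inl] at h1
  · simp only [Fintype.card_sum, Fintype.card_prod, Fintype.card_fin] at h1 h2
    omega
  · intro b hb
    funext p
    exact (sum_layerSum HZ κ _ p).symm.trans (sum_eq_zero_of_pad_add (pad_add_eq_layerSum hb p))
  · intro b hb h0
    have h0' : ∀ R, b (Sum.inl R) = 0 := congrFun h0
    funext r
    rcases r with R | ⟨p, k⟩
    · exact h0' R
    · refine (eq_partialSum_of_pad_add (pad_add_eq_layerSum hb p) k).trans ?_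
      simp [partialSum, layerSum, h0']
  · intro b hb
    refine ⟨Sum.elim b fun x => partialSum (layerSum HZ κ b x.1) (x.2 + 1), ?_, rfl⟩
    funext j
    rcases j with ⟨p, k⟩ | ⟨s, k⟩
    · rw [thickHZ_vecMul_inl]
      simp only [Sum.elim_inl, Sum.elim_inr]
      rw [pad_partialSum_add _ ((sum_layerSum HZ κ b p).trans (congrFun hb p))]
      exact CharTwo.add_self_eq_zero _
    · rw [thickHZ_vecMul_inr]
      simp only [Sum.elim_inr]
      rw [sum_mul_partialSum]
      simp [sum_mul_layerSum hCSS, partialSum]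

end Ranks

/-- Let `c ≥ 2` and let `C` be a CSS code with
`w_X, w_Z, q_X, q_Z ≤ c`.  Then for every `l ≥ 2` and every choice function `κ`, the
thickened code satisfies `Ñ = N·l + n_X·(l−1)`, `w̃_X ≤ c+2`, `w̃_Z ≤ c+2`, `q̃_X ≤ c`,
`q̃_Z ≤ c+2`, `K̃ = K`, and, if `K ≥ 1`, `d̃_X = l·d_X` and `d̃_Z = d_Z`. -/
theorem stmt13 (c : ℕ) (hc : 2 ≤ c)
    (HX : Matrix (Fin nX) (Fin N) (ZMod 2)) (HZ : Matrix (Fin nZ) (Fin N) (ZMod 2))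
    (hCSS : HX * HZ.transpose = 0)
    (hwX : maxRowW HX ≤ c) (hwZ : maxRowW HZ ≤ c)
    (hqX : maxColW HX ≤ c) (hqZ : maxColW HZ ≤ c)
    (l : ℕ) (hl : 2 ≤ l) (κ : Fin nZ → Fin l) :
    Fintype.card (TQubit N nX l) = N * l + nX * (l - 1) ∧
    (∀ r, wt (thickHX HX l r) ≤ c + 2) ∧
    (∀ r, wt (thickHZ HX HZ l κ r) ≤ c + 2) ∧
    (∀ p, wt (fun r => thickHX HX l r p) ≤ c) ∧
    (∀ p, wt (fun r => thickHZ HX HZ l κ r p) ≤ c + 2) ∧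
    (Fintype.card (TQubit N nX l) - (thickHX HX l).rank - (thickHZ HX HZ l κ).rank
        = N - HX.rank - HZ.rank) ∧
    (1 ≤ N - HX.rank - HZ.rank →
      distX (thickHX HX l) (thickHZ HX HZ l κ) = l * distX HX HZ ∧
      distZ (thickHX HX l) (thickHZ HX HZ l κ) = distZ HX HZ) := by
  have hl0 : 0 < l := by omega
  have hcard : Fintype.card (TQubit N nX l) = N * l + nX * (l - 1) := by simp
  refine ⟨hcard, fun r => ?_, fun r => ?_, fun p => ?_, fun p => ?_, ?_, fun _ =>
    ⟨distX_thick hCSS hl0 κ, distZ_thick hCSS hl0 κ⟩⟩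
  · have := wt_thickHX_row HX r
    omega
  · have := wt_thickHZ_row HX HZ κ r
    omega
  · have := wt_thickHX_col HX p
    omega
  · have := wt_thickHZ_col HX HZ κ p
    omega
  · have hX := rank_thickHX (HX := HX) hl0
    have hZ := rank_thickHZ hCSS κ
    rw [hcard]
    obtain ⟨m, rfl⟩ : ∃ m, l = m + 1 := ⟨l - 1, by omega⟩
    simp only [Nat.add_sub_cancel, mul_add, mul_one] at hX hZ ⊢
    omega
end
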